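/- arXiv:1608.06002 — 4 statements merged into one kernel-verified Lean document; each statement's English description precedes it below -/
import Mathlib

section
/- Let $c > 0$ and let $S$ be a finite set of points in the Euclidean plane that is not collinear. Call two distinct points $p, q \in S$ "mutually visible" if no point of $S$ lies strictly between them, i.e., no $r \in S$ belongs to the open segment joining $p$ and $q$. If there exist two points of $S$ at distance strictly greater than $2c$, then there exist two mutually visible points of $S$ at distance strictly greater than $c$. -/
/-- The signed area of the parallelogram spanned by `q - p` and `x - p`. -/
noncomputable def planarCross (p q x : EuclideanSpace ℝ (Fin 2)) : ℝ :=
  (q 0 - p 0) * (x 1 - p 1) - (q 1 - p 1) * (x 0 - p 0)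

theorem planarCross_left (p q : EuclideanSpace ℝ (Fin 2)) : planarCross p q p = 0 := by
  simp [planarCross]

theorem planarCross_right (p q : EuclideanSpace ℝ (Fin 2)) : planarCross p q q = 0 := by
  simp only [planarCross]; ring

theorem planarCross_combo (p q x y : EuclideanSpace ℝ (Fin 2)) {a b : ℝ} (hab : a + b = 1) :
    planarCross p q (a • x + b • y) = a * planarCross p q x + b * planarCross p q y := by
  obtain rfl : a = 1 - b := by linarith
  simp only [planarCross, PiLp.add_apply, PiLp.smul_apply, smul_eq_mul]
  ring

theorem collinear_of_planarCross_eq_zero {p q : EuclideanSpace ℝ (Fin 2)} (hpq : p ≠ q)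
    {S : Set (EuclideanSpace ℝ (Fin 2))} (h : ∀ x ∈ S, planarCross p q x = 0) :
    Collinear ℝ S := by
  rw [collinear_iff_exists_forall_eq_smul_vadd]
  refine ⟨p, q - p, fun x hx => ?_⟩
  have hx := h x hx
  simp only [planarCross] at hx
  have hn : (q 0 - p 0) ^ 2 + (q 1 - p 1) ^ 2 ≠ 0 := by
    intro h0
    apply hpq
    ext i
    fin_cases i <;> simp only [Fin.zero_eta, Fin.mk_one] <;>
      nlinarith [sq_nonneg (q 0 - p 0), sq_nonneg (q 1 - p 1)]
  refine ⟨((q 0 - p 0) * (x 0 - p 0) + (q 1 - p 1) * (x 1 - p 1)) /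
    ((q 0 - p 0) ^ 2 + (q 1 - p 1) ^ 2), ?_⟩
  ext i
  fin_cases i <;> simp only [Fin.zero_eta, Fin.mk_one, vadd_eq_add, PiLp.add_apply,
    PiLp.smul_apply, PiLp.sub_apply, smul_eq_mul] <;> field_simp
  · linear_combination (-(q 1 - p 1)) * hx
  · linear_combination (q 0 - p 0) * hx

/-- Paper's Lemma 1: in a non-collinear finite configuration, a pair of points at
distance more than `2c` forces a pair of mutually visible points at distance more
than `c`. -/
theorem stmt_0 (c : ℝ) (hc : 0 < c) (S : Finset (EuclideanSpace ℝ (Fin 2)))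
    (hnc : ¬ Collinear ℝ (S : Set (EuclideanSpace ℝ (Fin 2))))
    (hfar : ∃ p ∈ S, ∃ q ∈ S, dist p q > 2 * c) :
    ∃ p ∈ S, ∃ q ∈ S, p ≠ q ∧
      (∀ r ∈ S, r ∉ openSegment ℝ p q) ∧ dist p q > c := by
  obtain ⟨p, hp, q, hq, hd⟩ := hfar
  have hpq : p ≠ q := dist_pos.1 (by linarith)
  -- a point of `S` off the line `pq`, nearest to that line, sees every point of `S` on the line
  obtain ⟨r, hr, hmin⟩ := (S.filter fun x => planarCross p q x ≠ 0).exists_min_image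
    (fun x => |planarCross p q x|) (by
      by_contra hne
      rw [Finset.not_nonempty_iff_eq_empty, Finset.filter_eq_empty_iff] at hne
      exact hnc (collinear_of_planarCross_eq_zero hpq fun x hx => not_not.1 (hne hx)))
  obtain ⟨hrS, hr0⟩ := Finset.mem_filter.1 hr
  have visible : ∀ s, planarCross p q s = 0 →
      s ≠ r ∧ ∀ x ∈ S, x ∉ openSegment ℝ s r := by
    refine fun s hs => ⟨fun h => hr0 (h ▸ hs), ?_⟩
    rintro x hx ⟨a, b, ha, hb, hab, rfl⟩
    have hcross := planarCross_combo p q s r hab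
    rw [hs, mul_zero, zero_add] at hcross
    have hle := hmin _ (Finset.mem_filter.2 ⟨hx, by rw [hcross]; exact mul_ne_zero hb.ne' hr0⟩)
    rw [hcross, abs_mul, abs_of_pos hb] at hle
    nlinarith [abs_pos.2 hr0]
  have htri := dist_triangle_right p q r
  rcases lt_or_ge c (dist p r) with h | h
  · obtain ⟨hne, hv⟩ := visible p (planarCross_left p q)
    exact ⟨p, hp, r, hrS, hne, hv, h⟩
  · obtain ⟨hne, hv⟩ := visible q (planarCross_right p q)
    exact ⟨q, hq, r, hrS, hne, hv, by linarith⟩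
end

section
/- Let $n \ge 3$ be a natural number, $b > 0$ a real number, and let $A, B, C$ be points in the Euclidean plane with $\operatorname{dist}(A,B) = \operatorname{dist}(A,C) = \frac{b}{2}$ and with the angle $\angle B\, A\, C \le \pi - \frac{2\pi}{n}$. Then $\operatorname{dist}(A,B) + \operatorname{dist}(A,C) - \operatorname{dist}(B,C) \ge b\left(1 - \cos\tfrac{\pi}{n}\right) > 0$. -/
open EuclideanGeometry Real

/-- Strict-positivity form of the perimeter decrement in the paper's Lemma 3: with
`dist A B = dist A C = b/2` and angle `∠BAC ≤ π - 2π/n`, the decrement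
`AB + AC - BC` is at least `b (1 - cos(π/n)) > 0`. -/
theorem stmt_6 (n : ℕ) (hn : 3 ≤ n) (b : ℝ) (hb : 0 < b)
    (A B C : EuclideanSpace ℝ (Fin 2))
    (hAB : dist A B = b / 2) (hAC : dist A C = b / 2)
    (hangle : EuclideanGeometry.angle B A C ≤ π - 2 * π / n) :
    dist A B + dist A C - dist B C ≥ b * (1 - Real.cos (π / n)) ∧
      b * (1 - Real.cos (π / n)) > 0 := by
  have hn' : (3 : ℝ) ≤ n := by exact_mod_cast hn
  have hpos : 0 < π / n := by positivity
  have hle : π / n ≤ π / 3 := div_le_div_of_nonneg_left pi_pos.le (by norm_num) hn'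
  have hcos_lt : Real.cos (π / n) < 1 := by
    rw [← Real.cos_zero]
    exact Real.cos_lt_cos_of_nonneg_of_le_pi le_rfl (by linarith [pi_pos]) hpos
  have hcos_nonneg : 0 ≤ Real.cos (π / n) :=
    Real.cos_nonneg_of_mem_Icc ⟨by linarith [pi_pos], by linarith [pi_pos]⟩
  have hcos_angle : -Real.cos (2 * (π / n)) ≤ Real.cos (EuclideanGeometry.angle B A C) := by
    rw [← Real.cos_pi_sub, ← mul_div_assoc]
    exact Real.cos_le_cos_of_nonneg_of_le_pi (EuclideanGeometry.angle_nonneg B A C)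
      (by linarith [show 0 < 2 * π / n by positivity]) hangle
  have hBC : dist B C ≤ b * Real.cos (π / n) := by
    refine (sq_le_sq₀ dist_nonneg (by positivity)).1 ?_
    have hlaw := EuclideanGeometry.law_cos B A C
    rw [dist_comm B A, dist_comm C A, hAB, hAC] at hlaw
    rw [Real.cos_two_mul] at hcos_angle
    nlinarith [mul_le_mul_of_nonneg_left hcos_angle (sq_nonneg b)]
  constructor
  · rw [hAB, hAC]
    linarith
  · exact mul_pos hb (by linarith)
end

section
/- Fix $n \ge 1$ and $b > 0$. Consider the one-dimensional synchronous dynamics on positions $x \colon \operatorname{Fin} n \to \mathbb{R}$: letting $m = \min_i x(i)$ and $M = \max_i x(i)$, each robot $i$ with $x(i) = m < M$ moves to $x(i) + b$, each robot $i$ with $x(i) = M > m$ moves to $x(i) - b$, and all other robots stay put. Let $X \colon \mathbb{N} \to (\operatorname{Fin} n \to \mathbb{R})$ be any trajectory of this dynamics (i.e., $X(t+1)$ is obtained from $X(t)$ by this update). Then there exists a time $T$ such that for all $t \ge T$, $\max_i X(t)(i) - \min_i X(t)(i) \le 2b$. -/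
/-- The minimum position of the `n` robots. -/
noncomputable def lo {n : ℕ} (hn : 1 ≤ n) (x : Fin n → ℝ) : ℝ :=
  Finset.univ.inf' ⟨⟨0, hn⟩, Finset.mem_univ _⟩ x

/-- The maximum position of the `n` robots. -/
noncomputable def hi {n : ℕ} (hn : 1 ≤ n) (x : Fin n → ℝ) : ℝ :=
  Finset.univ.sup' ⟨⟨0, hn⟩, Finset.mem_univ _⟩ x

/-- One synchronous round of the one-dimensional OLA boundary-movement dynamics:
with `m = lo hn x` and `M = hi hn x`, if `m < M` then every robot at the minimum
moves to `m + b`, every robot at the maximum moves to `M - b`, and all other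
robots stay put. -/
noncomputable def step {n : ℕ} (hn : 1 ≤ n) (b : ℝ) (x : Fin n → ℝ) : Fin n → ℝ :=
  fun i =>
    if lo hn x < hi hn x then
      if x i = lo hn x then x i + b
      else if x i = hi hn x then x i - b
      else x i
    else x i

section StepLemmas

variable {n : ℕ} (hn : 1 ≤ n) {b : ℝ} (x : Fin n → ℝ)

theorem lo_le (i : Fin n) : lo hn x ≤ x i :=
  Finset.inf'_le _ (Finset.mem_univ i)

theorem le_hi (i : Fin n) : x i ≤ hi hn x :=
  Finset.le_sup' _ (Finset.mem_univ i)

theorem exists_eq_lo : ∃ i, x i = lo hn x := by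
  obtain ⟨i, -, h⟩ := Finset.exists_mem_eq_inf' (s := Finset.univ) ⟨⟨0, hn⟩, Finset.mem_univ _⟩ x
  exact ⟨i, h.symm⟩

theorem le_lo {a : ℝ} (h : ∀ i, a ≤ x i) : a ≤ lo hn x :=
  Finset.le_inf' _ _ fun i _ => h i

theorem hi_le {a : ℝ} (h : ∀ i, x i ≤ a) : hi hn x ≤ a :=
  Finset.sup'_le _ _ fun i _ => h i

theorem lo_le_lo_step (hb : 0 < b) (h : b ≤ hi hn x - lo hn x) :
    lo hn x ≤ lo hn (step hn b x) := by
  refine le_lo hn _ fun i => ?_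
  have := lo_le hn x i
  unfold step
  split_ifs <;> linarith

theorem hi_step_le_hi (hb : 0 < b) (h : b ≤ hi hn x - lo hn x) :
    hi hn (step hn b x) ≤ hi hn x := by
  refine hi_le hn _ fun i => ?_
  have := le_hi hn x i
  unfold step
  split_ifs <;> linarith

/-- An extent of at most `2b` is preserved by a round. -/
theorem extent_step_le (hb : 0 < b) (h : hi hn x - lo hn x ≤ 2 * b) :
    hi hn (step hn b x) - lo hn (step hn b x) ≤ 2 * b := by
  rcases le_or_gt b (hi hn x - lo hn x) with hD | hD
  · linarith [lo_le_lo_step hn x hb hD, hi_step_le_hi hn x hb hD]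
  · have hlo : hi hn x - b ≤ lo hn (step hn b x) := by
      refine le_lo hn _ fun i => ?_
      have := lo_le hn x i
      unfold step
      split_ifs <;> linarith
    have hhi : hi hn (step hn b x) ≤ lo hn x + b := by
      refine hi_le hn _ fun i => ?_
      have := le_hi hn x i
      unfold step
      split_ifs <;> linarith
    have := (lo_le hn x ⟨0, hn⟩).trans (le_hi hn x ⟨0, hn⟩)
    linarith

/-- A round brings the robots closer, by at least `b` in total, to any point at distance at least
`b` from both extremes. -/
theorem sum_abs_step_sub_le (hb : 0 < b) {c : ℝ} (hlo : lo hn x + b ≤ c) (hhi : c ≤ hi hn x - b) :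
    ∑ i, |step hn b x i - c| ≤ ∑ i, |x i - c| - b := by
  have hlt : lo hn x < hi hn x := by linarith
  obtain ⟨j, hj⟩ := exists_eq_lo hn x
  have hnonneg : ∀ i ∈ Finset.univ, 0 ≤ |x i - c| - |step hn b x i - c| := by
    intro i _
    unfold step
    rw [if_pos hlt]
    split_ifs with h1 h2
    · rw [abs_of_nonpos (by linarith), abs_of_nonpos (by linarith)]; linarith
    · rw [abs_of_nonneg (by linarith), abs_of_nonneg (by linarith)]; linarith
    · simp
  have hmove : |x j - c| - |step hn b x j - c| = b := by
    unfold step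
    rw [if_pos hlt, if_pos hj, abs_of_nonpos (by linarith), abs_of_nonpos (by linarith)]
    ring
  have := Finset.single_le_sum hnonneg (Finset.mem_univ j)
  rw [hmove, Finset.sum_sub_distrib] at this
  linarith

end StepLemmas

/-- Paper's Theorem on Algorithm ConvergeQuadrant (one dimension): along any
trajectory of the synchronous dynamics, eventually the extent `max - min` is at
most `2b` and remains so forever. -/
theorem stmt_7 (n : ℕ) (hn : 1 ≤ n) (b : ℝ) (hb : 0 < b)
    (X : ℕ → Fin n → ℝ) (hX : ∀ t, X (t + 1) = step hn b (X t)) :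
    ∃ T : ℕ, ∀ t ≥ T, hi hn (X t) - lo hn (X t) ≤ 2 * b := by
  suffices h : ∃ T, hi hn (X T) - lo hn (X T) ≤ 2 * b by
    obtain ⟨T, hT⟩ := h
    refine ⟨T, fun t ht => ?_⟩
    induction t, ht using Nat.le_induction with
    | base => exact hT
    | succ t _ ih => rw [hX]; exact extent_step_le hn _ hb ih
  by_contra! h
  have hlo : Monotone fun t => lo hn (X t) := monotone_nat_of_le_succ fun t => by
    rw [hX]; exact lo_le_lo_step hn _ hb (by linarith [h t])
  have hhi : Antitone fun t => hi hn (X t) := antitone_nat_of_succ_le fun t => by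
    rw [hX]; exact hi_step_le_hi hn _ hb (by linarith [h t])
  have hsep : ∀ s t, lo hn (X s) ≤ hi hn (X t) - 2 * b := fun s t => by
    have h1 := hlo (le_max_left s t)
    have h2 := hhi (le_max_right s t)
    dsimp only at h1 h2
    linarith [h (max s t)]
  have hbdd : BddAbove (Set.range fun t => lo hn (X t)) :=
    ⟨_, Set.forall_mem_range.2 fun s => hsep s 0⟩
  set c := (⨆ t, lo hn (X t)) + b with hc
  have hsum : ∀ t : ℕ, ∑ i, |X t i - c| ≤ ∑ i, |X 0 i - c| - t * b := by
    intro t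
    induction t with
    | zero => simp
    | succ t ih =>
      have h1 : lo hn (X t) ≤ ⨆ t, lo hn (X t) := le_ciSup hbdd t
      have h2 : ⨆ s, lo hn (X s) ≤ hi hn (X t) - 2 * b := ciSup_le fun s => hsep s t
      have := sum_abs_step_sub_le hn (X t) hb (c := c) (by linarith) (by linarith)
      rw [hX]
      push_cast
      linarith
  obtain ⟨t, ht⟩ := exists_nat_gt ((∑ i, |X 0 i - c|) / b)
  rw [div_lt_iff₀ hb] at ht
  have : 0 ≤ ∑ i, |X t i - c| := Finset.sum_nonneg fun i _ => abs_nonneg _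
  linarith [hsum t]
end

section
/- Let $D$ be a finite set of unit vectors in the Euclidean plane such that the zero vector lies in the interior of the convex hull of $D$. Let $r \in \mathbb{R}^2$, let $b > 0$, and let $v$ be any unit vector. Then there exist two radius assignments $t, t' \colon D \to \mathbb{R}$ with $t(d) > 0$ and $t'(d) > 0$ for all $d \in D$, such that $r + b \cdot v$ does NOT lie in the convex hull of $\{\, r + t(d) \cdot d : d \in D \,\}$, while $r + b \cdot v$ DOES lie in the convex hull of $\{\, r + t'(d) \cdot d : d \in D \,\}$. -/
/-- Geometric core of the paper's impossibility theorem: if `0` lies in the interior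
of the convex hull of the finite set `D` of observed unit directions, then for any
deterministic move `r ↦ r + b • v` of step length `b > 0` in a unit direction `v`,
there are two positive radius assignments `t, t'` along the same directions such
that the destination exits the convex hull of the first configuration but stays
inside the convex hull of the second. -/
theorem stmt_11 (D : Finset (EuclideanSpace ℝ (Fin 2)))
    (hunit : ∀ d ∈ D, ‖d‖ = 1)
    (h0 : (0 : EuclideanSpace ℝ (Fin 2)) ∈
      interior (convexHull ℝ (D : Set (EuclideanSpace ℝ (Fin 2)))))
    (r : EuclideanSpace ℝ (Fin 2)) (b : ℝ) (hb : 0 < b)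
    (v : EuclideanSpace ℝ (Fin 2)) (hv : ‖v‖ = 1) :
    ∃ t t' : EuclideanSpace ℝ (Fin 2) → ℝ,
      (∀ d ∈ D, 0 < t d) ∧ (∀ d ∈ D, 0 < t' d) ∧
      (r + b • v) ∉
        convexHull ℝ ((fun d => r + t d • d) '' (D : Set (EuclideanSpace ℝ (Fin 2)))) ∧
      (r + b • v) ∈
        convexHull ℝ ((fun d => r + t' d • d) '' (D : Set (EuclideanSpace ℝ (Fin 2)))) := by
  refine ⟨fun _ => b / 2, ?_⟩
  obtain ⟨ε, hε, hball⟩ := Metric.mem_nhds_iff.mp (mem_interior_iff_mem_nhds.mp h0)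
  have hmem : (ε / 2) • v ∈ convexHull ℝ (D : Set (EuclideanSpace ℝ (Fin 2))) := by
    apply hball
    rw [mem_ball_zero_iff, norm_smul, hv, Real.norm_of_nonneg (by positivity)]
    linarith
  refine ⟨fun _ => b / (ε / 2), fun _ _ => by positivity, fun _ _ => by positivity, ?_, ?_⟩
  · intro hin
    have hsub : (fun d => r + (b / 2) • d) '' (D : Set (EuclideanSpace ℝ (Fin 2))) ⊆
        Metric.closedBall r (b / 2) := by
      rintro _ ⟨d, hd, rfl⟩
      simp only [mem_closedBall_iff_norm, add_sub_cancel_left, norm_smul,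
        hunit d (Finset.mem_coe.mp hd), Real.norm_of_nonneg (half_pos hb).le, mul_one, le_refl]
    have hle := convexHull_min hsub (convex_closedBall r (b / 2)) hin
    rw [mem_closedBall_iff_norm, add_sub_cancel_left, norm_smul, hv,
      Real.norm_of_nonneg hb.le] at hle
    linarith
  · let f : EuclideanSpace ℝ (Fin 2) →ᵃ[ℝ] EuclideanSpace ℝ (Fin 2) :=
      AffineMap.const ℝ _ r +
        ((b / (ε / 2)) • (LinearMap.id : EuclideanSpace ℝ (Fin 2) →ₗ[ℝ] _)).toAffineMap
    have himage := f.image_convexHull (D : Set (EuclideanSpace ℝ (Fin 2)))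
    change _ ∈ convexHull ℝ (f '' _)
    rw [← himage]
    refine ⟨_, hmem, ?_⟩
    change r + (b / (ε / 2)) • (ε / 2) • v = r + b • v
    rw [smul_smul, div_mul_cancel₀ b (half_pos hε).ne']
end
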